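/- Let α ∈ (0,1). A probability measure ν on ℕ* (∑_{n≥1} ν(n) = 1) is m^α-invariant (i.e. a quasi-stationary distribution with eigenvalue m^α) if and only if there exists a locally finite Borel measure Λ on (0,∞) satisfying (a) Λ(A) = Λ(mA) for every Borel set A ⊆ (0,∞) and (b) ∫₀^∞ (1 − e^{−x})·x^{−α} Λ(dx) = 1, such that ∑_{n≥1} ν(n)·zⁿ = ∫₀^∞ (e^{(H(z)−1)x} − e^{−x})·x^{−α} Λ(dx) for every z ∈ (0,1). -/

import Mathlib

open MeasureTheory Real Set

/-- `convPow q i j` is the `i`-fold convolution power of the offspring distribution `q`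
evaluated at `j`, i.e. the transition matrix `P₀(i,j)` of the BGW process. -/
noncomputable def convPow (q : ℕ → ℝ) : ℕ → ℕ → ℝ
  | 0, j => if j = 0 then 1 else 0
  | i + 1, j => ∑ k ∈ Finset.range (j + 1), convPow q i (j - k) * q k

/-- `ν` is a `lam`-invariant measure on `ℕ* = {1,2,…}` of the BGW process killed at 0. -/
def IsInvMeasure (q : ℕ → ℝ) (lam : ℝ) (ν : ℕ → ℝ) : Prop :=
  (∀ n, 0 ≤ ν n) ∧ ν 0 = 0 ∧
  ∀ j : ℕ, 1 ≤ j →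
    Summable (fun i => ν i * convPow q i j) ∧
    ∑' i, ν i * convPow q i j = lam * ν j

/-- `Λ` is a locally finite Borel measure on `(0,∞)` (viewed as a measure on `ℝ` giving
no mass to `(-∞,0]` and finite mass to compact subsets of `(0,∞)`). -/
def IsLocFiniteOnPos (Λ : Measure ℝ) : Prop :=
  Λ (Set.Iic 0) = 0 ∧ ∀ K : Set ℝ, IsCompact K → K ⊆ Set.Ioi 0 → Λ K < ⊤

/-- `Λ(A) = Λ(mA)` for every Borel set `A ⊆ (0,∞)`. -/
def ScaleInvariant (m : ℝ) (Λ : Measure ℝ) : Prop :=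
  ∀ A : Set ℝ, MeasurableSet A → A ⊆ Set.Ioi 0 →
    Λ A = Λ ((fun x => m * x) '' A)


/-! ## Generating functions -/

open Filter Topology

/-- generating function -/
noncomputable def genFun (p : ℕ → ℝ) (z : ℝ) : ℝ := ∑' n, p n * z ^ n

lemma hasSum_congr_aux {f g : ℕ → ℝ} {a : ℝ} (h : ∀ n, f n = g n) (hg : HasSum g a) :
    HasSum f a := by
  rwa [show f = g from funext h]

section GF
variable {p : ℕ → ℝ}

lemma genFun_summable (hp0 : ∀ n, 0 ≤ p n) (hp1 : HasSum p 1) {z : ℝ} (hz : z ∈ Icc (0:ℝ) 1) :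
    Summable (fun n => p n * z ^ n) :=
  Summable.of_nonneg_of_le (fun n => mul_nonneg (hp0 n) (pow_nonneg hz.1 n))
    (fun n => mul_le_of_le_one_right (hp0 n) (pow_le_one₀ hz.1 hz.2)) hp1.summable

lemma genFun_one (hp1 : HasSum p 1) : genFun p 1 = 1 := by
  simp [genFun, hp1.tsum_eq]

lemma genFun_zero : genFun p 0 = p 0 := by
  unfold genFun
  rw [tsum_eq_single 0]
  · simp
  · intro b hb; simp [hb]

lemma genFun_mono (hp0 : ∀ n, 0 ≤ p n) (hp1 : HasSum p 1) {z w : ℝ} (hz : 0 ≤ z) (hzw : z ≤ w)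
    (hw : w ≤ 1) : genFun p z ≤ genFun p w :=
  (genFun_summable hp0 hp1 ⟨hz, hzw.trans hw⟩).tsum_le_tsum
    (fun n => mul_le_mul_of_nonneg_left (pow_le_pow_left₀ hz hzw n) (hp0 n))
    (genFun_summable hp0 hp1 ⟨hz.trans hzw, hw⟩)

lemma genFun_mem (hp0 : ∀ n, 0 ≤ p n) (hp1 : HasSum p 1) {z : ℝ} (hz : z ∈ Icc (0:ℝ) 1) :
    genFun p z ∈ Icc (0:ℝ) 1 :=
  ⟨tsum_nonneg (fun n => mul_nonneg (hp0 n) (pow_nonneg hz.1 n)), by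
    rw [← genFun_one hp1]; exact genFun_mono hp0 hp1 hz.1 hz.2 le_rfl⟩

lemma genFun_continuousOn (hp0 : ∀ n, 0 ≤ p n) (hp1 : HasSum p 1) :
    ContinuousOn (genFun p) (Icc 0 1) := by
  unfold genFun
  apply continuousOn_tsum (u := p)
  · intro i; fun_prop
  · exact hp1.summable
  · intro n x hx
    rw [Real.norm_of_nonneg (mul_nonneg (hp0 n) (pow_nonneg hx.1 n))]
    exact mul_le_of_le_one_right (hp0 n) (pow_le_one₀ hx.1 hx.2)

lemma one_sub_genFun (hp0 : ∀ n, 0 ≤ p n) (hp1 : HasSum p 1) {z : ℝ} (hz : z ∈ Icc (0:ℝ) 1) :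
    HasSum (fun n => p n * (1 - z ^ n)) (1 - genFun p z) := by
  simpa [mul_sub, genFun] using hp1.sub (genFun_summable hp0 hp1 hz).hasSum

lemma genFun_concave (hp0 : ∀ n, 0 ≤ p n) (hp1 : HasSum p 1) {z w : ℝ} (hz : 0 ≤ z) (hzw : z ≤ w)
    (hw : w ≤ 1) : (1 - genFun p z) * (1 - w) ≤ (1 - genFun p w) * (1 - z) := by
  refine hasSum_le (fun n => ?_)
    ((one_sub_genFun hp0 hp1 ⟨hz, hzw.trans hw⟩).mul_right (1 - w))
    ((one_sub_genFun hp0 hp1 ⟨hz.trans hzw, hw⟩).mul_right (1 - z))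
  have h1 : (1 - z ^ n) = (∑ i ∈ Finset.range n, z ^ i) * (1 - z) := by
    rw [geom_sum_mul_neg]
  have h2 : (1 - w ^ n) = (∑ i ∈ Finset.range n, w ^ i) * (1 - w) := by
    rw [geom_sum_mul_neg]
  have h3 : (∑ i ∈ Finset.range n, z ^ i) ≤ (∑ i ∈ Finset.range n, w ^ i) :=
    Finset.sum_le_sum (fun i _ => pow_le_pow_left₀ hz hzw i)
  rw [h1, h2]
  have h4 : 0 ≤ p n * ((1 - z) * (1 - w)) :=
    mul_nonneg (hp0 n) (mul_nonneg (by linarith) (by linarith))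
  nlinarith [mul_le_mul_of_nonneg_left h3 h4]

lemma genFun_le_self (hp0 : ∀ n, 0 ≤ p n) (hp1 : HasSum p 1) (hp00 : p 0 = 0) {z : ℝ}
    (hz : z ∈ Icc (0:ℝ) 1) : genFun p z ≤ z := by
  refine hasSum_le (fun n => ?_) (genFun_summable hp0 hp1 hz).hasSum
    (by simpa using hp1.mul_right z)
  rcases n with _ | n
  · simp [hp00]
  · exact mul_le_mul_of_nonneg_left (pow_le_of_le_one hz.1 hz.2 (by simp)) (hp0 _)

lemma one_sub_genFun_le {m : ℝ} (hp0 : ∀ n, 0 ≤ p n) (hp1 : HasSum p 1)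
    (hm : HasSum (fun k : ℕ => (k : ℝ) * p k) m) {z : ℝ}
    (hz : z ∈ Icc (0:ℝ) 1) : 1 - genFun p z ≤ m * (1 - z) := by
  refine hasSum_le (fun n => ?_) (one_sub_genFun hp0 hp1 hz) (hm.mul_right (1 - z))
  have h1 : (1 - z ^ n) = (∑ i ∈ Finset.range n, z ^ i) * (1 - z) := by
    rw [geom_sum_mul_neg]
  have h3 : (∑ i ∈ Finset.range n, z ^ i) ≤ n := by
    calc (∑ i ∈ Finset.range n, z ^ i) ≤ ∑ i ∈ Finset.range n, (1:ℝ) :=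
          Finset.sum_le_sum (fun i _ => pow_le_one₀ hz.1 hz.2)
      _ = n := by simp
  rw [h1]
  have h4 : 0 ≤ p n * (1 - z) := mul_nonneg (hp0 n) (by linarith [hz.2])
  nlinarith [mul_le_mul_of_nonneg_left h3 h4]

lemma slope_tendsto {m : ℝ} (hp0 : ∀ n, 0 ≤ p n) (hp1 : HasSum p 1)
    (hm : HasSum (fun k : ℕ => (k : ℝ) * p k) m) {v : ℕ → ℝ} (hv : ∀ n, v n ∈ Ico (0:ℝ) 1)
    (hv1 : Tendsto v atTop (𝓝 1)) :
    Tendsto (fun n => (1 - genFun p (v n)) / (1 - v n)) atTop (𝓝 m) := by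
  have key : ∀ n, (1 - genFun p (v n)) / (1 - v n)
      = ∑' k, p k * ∑ i ∈ Finset.range k, (v n) ^ i := by
    intro n
    have := (one_sub_genFun hp0 hp1 ⟨(hv n).1, (hv n).2.le⟩).div_const (1 - v n)
    rw [← this.tsum_eq]
    congr 1; ext k
    rw [← geom_sum_mul_neg]
    have : 1 - v n ≠ 0 := by linarith [(hv n).2]
    field_simp
  simp_rw [key]
  rw [← hm.tsum_eq]
  apply tendsto_tsum_of_dominated_convergence (bound := fun k : ℕ => (k : ℝ) * p k) hm.summable
  · intro k
    have : Tendsto (fun n => p k * ∑ i ∈ Finset.range k, (v n) ^ i) atTop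
        (𝓝 (p k * ∑ i ∈ Finset.range k, (1:ℝ) ^ i)) := by
      apply Tendsto.const_mul
      apply tendsto_finsetSum
      intro i _
      exact hv1.pow i
    simpa [mul_comm] using this
  · refine Eventually.of_forall (fun n k => ?_)
    have h3 : (∑ i ∈ Finset.range k, (v n) ^ i) ≤ k := by
      calc (∑ i ∈ Finset.range k, (v n) ^ i) ≤ ∑ i ∈ Finset.range k, (1:ℝ) :=
            Finset.sum_le_sum (fun i _ => pow_le_one₀ (hv n).1 (hv n).2.le)
        _ = k := by simp
    have h4 : 0 ≤ (∑ i ∈ Finset.range k, (v n) ^ i) :=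
      Finset.sum_nonneg (fun i _ => pow_nonneg (hv n).1 i)
    rw [Real.norm_of_nonneg (mul_nonneg (hp0 k) h4), mul_comm (k:ℝ)]
    exact mul_le_mul_of_nonneg_left h3 (hp0 k)

end GF

/-! ## Functional equation -/

section FE
variable {q : ℕ → ℝ}

lemma convPow_nonneg (hq0 : ∀ n, 0 ≤ q n) (i j : ℕ) : 0 ≤ convPow q i j := by
  induction i generalizing j with
  | zero => simp only [convPow]; split_ifs <;> norm_num
  | succ i ih => exact Finset.sum_nonneg (fun k _ => mul_nonneg (ih _) (hq0 k))

lemma convPow_hasSum (hq0 : ∀ n, 0 ≤ q n) (hq1 : HasSum q 1) {z : ℝ} (hz : z ∈ Icc (0:ℝ) 1)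
    (i : ℕ) : HasSum (fun j => convPow q i j * z ^ j) (genFun q z ^ i) := by
  induction i with
  | zero =>
    have : (fun j => convPow q 0 j * z ^ j) = fun j => if j = 0 then 1 else 0 := by
      ext j; by_cases h : j = 0 <;> simp [convPow, h]
    rw [this, pow_zero]
    exact hasSum_ite_eq 0 1
  | succ i ih =>
    have hs := genFun_summable hq0 hq1 hz
    have hn1 : Summable fun j => ‖convPow q i j * z ^ j‖ := by
      simpa using ih.summable.abs
    have hn2 : Summable fun j => ‖q j * z ^ j‖ := by
      simpa using hs.abs
    have h := hasSum_sum_range_mul_of_summable_norm hn1 hn2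
    rw [ih.tsum_eq] at h
    rw [pow_succ]
    refine hasSum_congr_aux (fun j => ?_) h
    simp only [convPow]
    rw [← Finset.sum_range_reflect, Finset.sum_mul]
    apply Finset.sum_congr rfl
    intro k hk
    have hk' : k ≤ j := by simpa [Nat.lt_succ_iff] using hk
    have e1 : j + 1 - 1 - k = j - k := by omega
    have e2 : j - (j - k) = k := by omega
    rw [e1, e2]
    have : z ^ j = z ^ k * z ^ (j - k) := by rw [← pow_add]; congr 1; omega
    rw [this]; ring

lemma convPow_le_one (hq0 : ∀ n, 0 ≤ q n) (hq1 : HasSum q 1) (i j : ℕ) : convPow q i j ≤ 1 := by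
  have h := convPow_hasSum hq0 hq1 (z := 1) ⟨zero_le_one, le_rfl⟩ i
  simp only [one_pow, mul_one, genFun_one hq1] at h
  exact le_hasSum h j (fun k _ => convPow_nonneg hq0 i k)

lemma genFun_comp (hq0 : ∀ n, 0 ≤ q n) (hq1 : HasSum q 1) {ν : ℕ → ℝ}
    (hν0 : ∀ n, 0 ≤ ν n) (hν1 : HasSum ν 1) {z : ℝ} (hz : z ∈ Icc (0:ℝ) 1) :
    HasSum (fun j => (∑' i, ν i * convPow q i j) * z ^ j) (genFun ν (genFun q z)) := by
  have hf := genFun_mem hq0 hq1 hz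
  have hS : Summable (fun x : ℕ × ℕ => ν x.1 * (convPow q x.1 x.2 * z ^ x.2)) := by
    rw [summable_prod_of_nonneg]
    · refine ⟨fun i => ((convPow_hasSum hq0 hq1 hz i).mul_left (ν i)).summable, ?_⟩
      simp_rw [((convPow_hasSum hq0 hq1 hz _).mul_left (ν _)).tsum_eq]
      exact genFun_summable hν0 hν1 hf
    · intro x
      exact mul_nonneg (hν0 _) (mul_nonneg (convPow_nonneg hq0 _ _) (pow_nonneg hz.1 _))
  have h1 : genFun ν (genFun q z) = ∑' i, ∑' j, ν i * (convPow q i j * z ^ j) := by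
    simp_rw [((convPow_hasSum hq0 hq1 hz _).mul_left (ν _)).tsum_eq]
    rfl
  have hS' : Summable (fun x : ℕ × ℕ => ν x.2 * (convPow q x.2 x.1 * z ^ x.1)) :=
    hS.prod_symm
  have h2 : ∀ j, (∑' i, ν i * convPow q i j) * z ^ j = ∑' i, ν i * (convPow q i j * z ^ j) := by
    intro j
    rw [← tsum_mul_right]
    congr 1; ext i; ring
  simp_rw [h2]
  have h3 := hS'.prod.hasSum
  rw [h1, (hS'.tsum_comm (f := fun j i => ν i * (convPow q i j * z ^ j)))]
  exact h3

lemma inv_summable (hq0 : ∀ n, 0 ≤ q n) (hq1 : HasSum q 1) {ν : ℕ → ℝ}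
    (hν0 : ∀ n, 0 ≤ ν n) (hν1 : HasSum ν 1) (j : ℕ) :
    Summable (fun i => ν i * convPow q i j) :=
  Summable.of_nonneg_of_le (fun n => mul_nonneg (hν0 n) (convPow_nonneg hq0 _ _))
    (fun n => mul_le_of_le_one_right (hν0 n) (convPow_le_one hq0 hq1 _ _)) hν1.summable

lemma funEq_of_inv (hq0 : ∀ n, 0 ≤ q n) (hq1 : HasSum q 1) {ν : ℕ → ℝ} {lam : ℝ}
    (hν : IsInvMeasure q lam ν) (hν1 : HasSum ν 1) {z : ℝ} (hz : z ∈ Icc (0:ℝ) 1) :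
    1 - genFun ν (genFun q z) = lam * (1 - genFun ν z) := by
  obtain ⟨hν0, hν00, hinv⟩ := hν
  have key : ∀ z ∈ Icc (0:ℝ) 1, genFun ν (genFun q z) =
      (∑' i, ν i * convPow q i 0) + lam * genFun ν z := by
    intro z hz
    have h := genFun_comp hq0 hq1 hν0 hν1 hz
    have h' := (genFun_summable hν0 hν1 hz).hasSum.mul_left lam
    have h'' := (hasSum_ite_eq 0 (∑' i, ν i * convPow q i 0)).add h'
    refine h.unique ((hasSum_congr_aux (fun j => ?_) h''))
    rcases j with _ | j
    · simp [hν00]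
    · rw [(hinv (j+1) (by simp)).2]; simp; ring
  have h1 := key 1 ⟨zero_le_one, le_rfl⟩
  rw [genFun_one hq1, genFun_one hν1] at h1
  rw [key z hz]; linarith

lemma coeff_zero_of_tsum_zero {d : ℕ → ℝ} {C : ℝ} (hd : ∀ n, |d n| ≤ C)
    (h : ∀ z ∈ Ioo (0:ℝ) 1, ∑' n, d n * z ^ n = 0) (n : ℕ) : d n = 0 := by
  have hsum : ∀ (k : ℕ) (z : ℝ), z ∈ Ioo (0:ℝ) 1 → Summable (fun n => d (n + k) * z ^ n) := by
    intro k z hz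
    refine Summable.of_norm_bounded (g := fun n => C * z ^ n)
      ((summable_geometric_of_lt_one hz.1.le hz.2).mul_left C) (fun n => ?_)
    rw [norm_mul, Real.norm_eq_abs, Real.norm_of_nonneg (pow_nonneg hz.1.le n)]
    exact mul_le_mul_of_nonneg_right (hd _) (pow_nonneg hz.1.le n)
  induction n using Nat.strong_induction_on with
  | _ n ih =>
    have h1 : ∀ z ∈ Ioo (0:ℝ) 1, ∑' k, d (k + n) * z ^ k = 0 := by
      intro z hz
      have h2 := (hsum 0 z hz).sum_add_tsum_nat_add n
      simp only [add_zero] at h2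
      rw [h z hz, Finset.sum_eq_zero (fun i hi => by rw [ih i (Finset.mem_range.1 hi), zero_mul]),
        zero_add] at h2
      have h3 : ∑' k, d (k + n) * z ^ (k + n) = (∑' k, d (k + n) * z ^ k) * z ^ n := by
        rw [← tsum_mul_right]; congr 1; ext k; ring
      rw [h3] at h2
      exact (mul_eq_zero.1 h2).resolve_right (pow_ne_zero _ hz.1.ne')
    have h4 : Tendsto (fun z : ℝ => ∑' k, d (k + n) * z ^ k) (𝓝[>] 0)
        (𝓝 (∑' k, d (k + n) * (0:ℝ) ^ k)) := by
      apply tendsto_tsum_of_dominated_convergence (bound := fun k => C * (1/2:ℝ) ^ k)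
      · exact (summable_geometric_of_lt_one (by norm_num) (by norm_num)).mul_left C
      · intro k
        apply Tendsto.const_mul
        exact ((continuous_pow k).tendsto 0).mono_left nhdsWithin_le_nhds
      · filter_upwards [Ioo_mem_nhdsGT (show (0:ℝ) < 1/2 by norm_num)] with z hz k
        rw [norm_mul, Real.norm_eq_abs, Real.norm_of_nonneg (pow_nonneg hz.1.le k)]
        exact mul_le_mul (hd _) (pow_le_pow_left₀ hz.1.le hz.2.le k) (pow_nonneg hz.1.le k)
          ((abs_nonneg _).trans (hd 0))
    have h5 : Tendsto (fun z : ℝ => ∑' k, d (k + n) * z ^ k) (𝓝[>] 0) (𝓝 0) := by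
      refine tendsto_const_nhds.congr' ?_
      filter_upwards [Ioo_mem_nhdsGT (show (0:ℝ) < 1 by norm_num)] with z hz
      exact (h1 z hz).symm
    have h6 := tendsto_nhds_unique h4 h5
    rw [tsum_eq_single 0 (fun b hb => by simp [hb])] at h6
    simpa using h6

lemma inv_of_funEq (hq0 : ∀ n, 0 ≤ q n) (hq1 : HasSum q 1) {ν : ℕ → ℝ} {lam : ℝ}
    (hν0 : ∀ n, 0 ≤ ν n) (hν00 : ν 0 = 0) (hν1 : HasSum ν 1)
    (h : ∀ z ∈ Ioo (0:ℝ) 1, 1 - genFun ν (genFun q z) = lam * (1 - genFun ν z)) :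
    IsInvMeasure q lam ν := by
  refine ⟨hν0, hν00, fun j hj => ⟨inv_summable hq0 hq1 hν0 hν1 j, ?_⟩⟩
  set c : ℕ → ℝ := fun j => ∑' i, ν i * convPow q i j with hc
  have hc0 : ∀ j, 0 ≤ c j := fun j =>
    tsum_nonneg (fun n => mul_nonneg (hν0 n) (convPow_nonneg hq0 _ _))
  have hc1 : ∀ j, c j ≤ 1 := fun j => by
    rw [← hν1.tsum_eq]
    exact (inv_summable hq0 hq1 hν0 hν1 j).tsum_le_tsum
      (fun n => mul_le_of_le_one_right (hν0 n) (convPow_le_one hq0 hq1 _ _)) hν1.summable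
  have hν1' : ∀ j, ν j ≤ 1 := fun j => le_hasSum hν1 j (fun k _ => hν0 k)
  set d : ℕ → ℝ := fun j => c j - (if j = 0 then 1 - lam else 0) - lam * ν j with hd
  have hdb : ∀ n, |d n| ≤ 1 + |1 - lam| + |lam| := by
    intro n
    have e1 : |c n| ≤ 1 := by rw [abs_of_nonneg (hc0 n)]; exact hc1 n
    have e2 : |if n = 0 then 1 - lam else 0| ≤ |1 - lam| := by
      split_ifs <;> simp
    have e3 : |lam * ν n| ≤ |lam| := by
      rw [abs_mul, abs_of_nonneg (hν0 n)]
      exact mul_le_of_le_one_right (abs_nonneg _) (hν1' n)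
    calc |d n| ≤ |c n - (if n = 0 then 1 - lam else 0)| + |lam * ν n| := abs_sub _ _
      _ ≤ |c n| + |if n = 0 then 1 - lam else 0| + |lam * ν n| := by
        gcongr; exact abs_sub _ _
      _ ≤ _ := by gcongr
  have := coeff_zero_of_tsum_zero hdb (fun z hz => ?_) j
  · simp only [hd] at this
    rw [if_neg (by omega)] at this
    linarith
  · have hz' : z ∈ Icc (0:ℝ) 1 := ⟨hz.1.le, hz.2.le⟩
    have h1 := genFun_comp hq0 hq1 hν0 hν1 hz'
    have h' := (genFun_summable hν0 hν1 hz').hasSum.mul_left lam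
    have h'' := (h1.sub (hasSum_ite_eq 0 (1 - lam))).sub h'
    have h3 : genFun ν (genFun q z) - (1 - lam) - lam * ∑' n, ν n * z ^ n = 0 := by
      have := h z hz
      change _ - _ - lam * genFun ν z = 0
      linarith
    rw [h3] at h''
    rw [← h''.tsum_eq]
    congr 1; ext n
    simp only [hd, hc]
    rcases n with _ | n
    · simp
    · simp; ring

end FE

/-! ## Asymptotics of the iterates -/

section Asymp
variable {q : ℕ → ℝ} {m : ℝ}

lemma iter_mem (hq0 : ∀ n, 0 ≤ q n) (hq1 : HasSum q 1) {z : ℝ} (hz : z ∈ Icc (0:ℝ) 1) (n : ℕ) :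
    (genFun q)^[n] z ∈ Icc (0:ℝ) 1 := by
  induction n with
  | zero => simpa using hz
  | succ n ih => rw [Function.iterate_succ_apply']; exact genFun_mem hq0 hq1 ih

lemma iter_mono (hq0 : ∀ n, 0 ≤ q n) (hq1 : HasSum q 1) {z w : ℝ} (hz : z ∈ Icc (0:ℝ) 1)
    (hw : w ∈ Icc (0:ℝ) 1) (hzw : z ≤ w) (n : ℕ) :
    (genFun q)^[n] z ≤ (genFun q)^[n] w := by
  induction n with
  | zero => simpa using hzw
  | succ n ih =>
    rw [Function.iterate_succ_apply', Function.iterate_succ_apply']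
    exact genFun_mono hq0 hq1 (iter_mem hq0 hq1 hz n).1 ih (iter_mem hq0 hq1 hw n).2

lemma iter_funEq (hq0 : ∀ n, 0 ≤ q n) (hq1 : HasSum q 1) {ν : ℕ → ℝ} {lam : ℝ}
    (h : ∀ z ∈ Icc (0:ℝ) 1, 1 - genFun ν (genFun q z) = lam * (1 - genFun ν z))
    {z : ℝ} (hz : z ∈ Icc (0:ℝ) 1) (n : ℕ) :
    1 - genFun ν ((genFun q)^[n] z) = lam ^ n * (1 - genFun ν z) := by
  induction n with
  | zero => simp
  | succ n ih =>
    rw [Function.iterate_succ_apply', h _ (iter_mem hq0 hq1 hz n), ih]; ring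

lemma one_sub_iter_le (hq0 : ∀ n, 0 ≤ q n) (hq1 : HasSum q 1)
    (hm : HasSum (fun k : ℕ => (k : ℝ) * q k) m) (hm0 : 0 < m)
    {z : ℝ} (hz : z ∈ Icc (0:ℝ) 1) (n : ℕ) :
    1 - (genFun q)^[n] z ≤ m ^ n * (1 - z) := by
  induction n with
  | zero => simp
  | succ n ih =>
    rw [Function.iterate_succ_apply']
    refine (one_sub_genFun_le hq0 hq1 hm (iter_mem hq0 hq1 hz n)).trans ?_
    calc m * (1 - (genFun q)^[n] z) ≤ m * (m ^ n * (1 - z)) :=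
          mul_le_mul_of_nonneg_left ih hm0.le
      _ = _ := by ring

lemma iter_lt_one (hq0 : ∀ n, 0 ≤ q n) (hq1 : HasSum q 1) (hm0 : 0 < m)
    {ν : ℕ → ℝ} (hν0 : ∀ n, 0 ≤ ν n) (hν00 : ν 0 = 0) (hν1 : HasSum ν 1)
    (h : ∀ z ∈ Icc (0:ℝ) 1, 1 - genFun ν (genFun q z) = m * (1 - genFun ν z))
    {z : ℝ} (hz : z ∈ Ico (0:ℝ) 1) (n : ℕ) : (genFun q)^[n] z < 1 := by
  have hz' : z ∈ Icc (0:ℝ) 1 := ⟨hz.1, hz.2.le⟩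
  refine lt_of_le_of_ne (iter_mem hq0 hq1 hz' n).2 (fun he => ?_)
  have h1 := iter_funEq hq0 hq1 h hz' n
  rw [he, genFun_one hν1] at h1
  have h2 := genFun_le_self hν0 hν1 hν00 hz'
  have h3 : 0 < m ^ n * (1 - genFun ν z) := mul_pos (pow_pos hm0 n) (by linarith [hz.2])
  linarith

lemma iter_tendsto (hq0 : ∀ n, 0 ≤ q n) (hq1 : HasSum q 1)
    (hm : HasSum (fun k : ℕ => (k : ℝ) * q k) m) (hm0 : 0 < m) (hm1 : m < 1)
    {z : ℝ} (hz : z ∈ Icc (0:ℝ) 1) :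
    Tendsto (fun n => (genFun q)^[n] z) atTop (𝓝 1) := by
  have h1 : Tendsto (fun n => 1 - m ^ n * (1 - z)) atTop (𝓝 (1 - 0 * (1 - z))) :=
    ((tendsto_pow_atTop_nhds_zero_of_lt_one hm0.le hm1).mul_const _).const_sub 1
  simp only [zero_mul, sub_zero] at h1
  refine tendsto_of_tendsto_of_tendsto_of_le_of_le h1 tendsto_const_nhds (fun n => ?_)
    (fun n => (iter_mem hq0 hq1 hz n).2)
  have := one_sub_iter_le hq0 hq1 hm hm0 hz n
  simp only; linarith

lemma iter_ratio_add (hq0 : ∀ n, 0 ≤ q n) (hq1 : HasSum q 1)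
    (hm : HasSum (fun k : ℕ => (k : ℝ) * q k) m) (hm0 : 0 < m) (hm1 : m < 1)
    {z : ℝ} (hz : z ∈ Icc (0:ℝ) 1) (hlt : ∀ n, (genFun q)^[n] z < 1) (k : ℕ) :
    Tendsto (fun n => (1 - (genFun q)^[n + k] z) / (1 - (genFun q)^[n] z)) atTop (𝓝 (m ^ k)) := by
  have hne : ∀ n, 1 - (genFun q)^[n] z ≠ 0 := fun n => by linarith [hlt n]
  induction k with
  | zero => simp [hne]
  | succ k ih =>
    have h1 : Tendsto (fun n => (1 - (genFun q)^[n + 1] z) / (1 - (genFun q)^[n] z)) atTop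
        (𝓝 m) := by
      simp_rw [Function.iterate_succ_apply']
      exact slope_tendsto hq0 hq1 hm (fun n => ⟨(iter_mem hq0 hq1 hz n).1, hlt n⟩)
        (iter_tendsto hq0 hq1 hm hm0 hm1 hz)
    have h2 := (h1.comp (tendsto_add_atTop_nat k)).mul ih
    rw [pow_succ, mul_comm]
    refine h2.congr (fun n => ?_)
    simp only [Function.comp]
    rw [div_mul_div_cancel₀ (hne _)]
    rfl

lemma iter_ratio (hq0 : ∀ n, 0 ≤ q n) (hq1 : HasSum q 1)
    (hm : HasSum (fun k : ℕ => (k : ℝ) * q k) m) (hm0 : 0 < m) (hm1 : m < 1)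
    {ν : ℕ → ℝ} (hν0 : ∀ n, 0 ≤ ν n) (hν00 : ν 0 = 0) (hν1 : HasSum ν 1)
    (h : ∀ z ∈ Icc (0:ℝ) 1, 1 - genFun ν (genFun q z) = m * (1 - genFun ν z))
    {z : ℝ} (hz : z ∈ Ico (0:ℝ) 1) :
    Tendsto (fun n => (1 - (genFun q)^[n] z) / (1 - (genFun q)^[n] 0)) atTop
      (𝓝 (1 - genFun ν z)) := by
  have hz' : z ∈ Icc (0:ℝ) 1 := ⟨hz.1, hz.2.le⟩
  have h0 : (0:ℝ) ∈ Icc (0:ℝ) 1 := ⟨le_rfl, zero_le_one⟩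
  have hlt := fun n => iter_lt_one hq0 hq1 hm0 hν0 hν00 hν1 h hz n
  have hlt0 := fun n => iter_lt_one hq0 hq1 hm0 hν0 hν00 hν1 h
    (z := 0) ⟨le_rfl, zero_lt_one⟩ n
  obtain ⟨k, hk⟩ : ∃ k, z ≤ (genFun q)^[k] 0 := by
    have := (iter_tendsto hq0 hq1 hm hm0 hm1 h0).eventually (lt_mem_nhds hz.2)
    obtain ⟨k, hk⟩ := this.exists
    exact ⟨k, hk.le⟩
  have hs : 0 < 1 - genFun ν z := by
    linarith [genFun_le_self hν0 hν1 hν00 hz', hz.2]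
  have hz0 : ∀ n, 1 - genFun ν ((genFun q)^[n] 0) = m ^ n := by
    intro n; rw [iter_funEq hq0 hq1 h h0, genFun_zero, hν00]; ring
  have hzn : ∀ n, 1 - genFun ν ((genFun q)^[n] z) = m ^ n * (1 - genFun ν z) :=
    fun n => iter_funEq hq0 hq1 h hz' n
  have hL := ((iter_ratio_add hq0 hq1 hm hm0 hm1 h0 hlt0 k).const_mul ((1 - genFun ν z) / m ^ k))
  rw [div_mul_cancel₀ _ (pow_pos hm0 k).ne'] at hL
  refine tendsto_of_tendsto_of_tendsto_of_le_of_le hL tendsto_const_nhds (fun n => ?_) (fun n => ?_)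
  · simp only
    have e1 : (genFun q)^[n] z ≤ (genFun q)^[n + k] 0 := by
      rw [Function.iterate_add_apply]
      exact iter_mono hq0 hq1 hz' (iter_mem hq0 hq1 h0 k) hk n
    have e2 := genFun_concave hν0 hν1 (iter_mem hq0 hq1 hz' n).1 e1 (iter_mem hq0 hq1 h0 _).2
    rw [hz0, hzn] at e2
    have hb : 0 < 1 - (genFun q)^[n] 0 := by linarith [hlt0 n]
    rw [← mul_div_assoc]
    apply div_le_div_of_nonneg_right _ hb.le
    rw [div_mul_eq_mul_div, div_le_iff₀ (pow_pos hm0 k)]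
    rw [pow_add, mul_assoc, mul_assoc] at e2
    have := le_of_mul_le_mul_left e2 (pow_pos hm0 n)
    linarith
  · simp only
    have e1 : (genFun q)^[n] 0 ≤ (genFun q)^[n] z := iter_mono hq0 hq1 h0 hz' hz.1 n
    have e2 := genFun_concave hν0 hν1 (iter_mem hq0 hq1 h0 n).1 e1 (iter_mem hq0 hq1 hz' _).2
    rw [hz0, hzn, mul_assoc] at e2
    have := le_of_mul_le_mul_left e2 (pow_pos hm0 n)
    have hb : 0 < 1 - (genFun q)^[n] 0 := by linarith [hlt0 n]
    rw [div_le_iff₀ hb]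
    exact this

lemma rpow_slope {v : ℕ → ℝ} (hv : ∀ n, v n ∈ Ico (0:ℝ) 1) (hv1 : Tendsto v atTop (𝓝 1)) (t : ℝ) :
    Tendsto (fun n => (1 - v n ^ t) / (1 - v n)) atTop (𝓝 t) := by
  have h1 : HasDerivAt (fun x : ℝ => x ^ t) t 1 := by
    simpa using Real.hasDerivAt_rpow_const (x := 1) (p := t) (Or.inl one_ne_zero)
  rw [hasDerivAt_iff_tendsto_slope] at h1
  have h2 : Tendsto v atTop (𝓝[≠] 1) :=
    tendsto_nhdsWithin_iff.2 ⟨hv1, Eventually.of_forall (fun n => (hv n).2.ne)⟩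
  refine (h1.comp h2).congr (fun n => ?_)
  simp only [Function.comp, slope_def_field, Real.one_rpow]
  rw [← neg_div_neg_eq]; congr 1 <;> ring

lemma ratio_bounds {p : ℕ → ℝ} (hp0 : ∀ n, 0 ≤ p n) (hp1 : HasSum p 1) {x y : ℝ}
    (hx : x ∈ Icc (0:ℝ) 1) (hy : y ∈ Ico (0:ℝ) 1) (hG : genFun p y < 1) :
    min 1 ((1 - x) / (1 - y)) ≤ (1 - genFun p x) / (1 - genFun p y) ∧
    (1 - genFun p x) / (1 - genFun p y) ≤ max 1 ((1 - x) / (1 - y)) := by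
  have h1 : 0 < 1 - y := by linarith [hy.2]
  have h2 : 0 < 1 - genFun p y := by linarith
  rcases le_total x y with hxy | hxy
  · have e1 := genFun_mono hp0 hp1 hx.1 hxy hy.2.le
    have e2 := genFun_concave hp0 hp1 hx.1 hxy hy.2.le
    constructor
    · apply (min_le_left _ _).trans
      rw [one_le_div h2]; linarith
    · apply le_trans _ (le_max_right _ _)
      rw [div_le_div_iff₀ h2 h1]; linarith
  · have e1 := genFun_mono hp0 hp1 hy.1 hxy hx.2
    have e2 := genFun_concave hp0 hp1 hy.1 hxy hx.2
    constructor
    · apply (min_le_right _ _).trans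
      rw [div_le_div_iff₀ h1 h2]; linarith
    · apply le_trans _ (le_max_left _ _)
      rw [div_le_one h2]; linarith

lemma main_limit (hq0 : ∀ n, 0 ≤ q n) (hq1 : HasSum q 1)
    (hm : HasSum (fun k : ℕ => (k : ℝ) * q k) m) (hm0 : 0 < m) (hm1 : m < 1)
    {νm : ℕ → ℝ} (hνm0 : ∀ n, 0 ≤ νm n) (hνm00 : νm 0 = 0) (hνm1 : HasSum νm 1)
    (hH : ∀ z ∈ Icc (0:ℝ) 1, 1 - genFun νm (genFun q z) = m * (1 - genFun νm z))
    {ν : ℕ → ℝ} (hν0 : ∀ n, 0 ≤ ν n) (hν00 : ν 0 = 0) (hν1 : HasSum ν 1) {lam : ℝ}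
    (hlam : 0 < lam)
    (hG : ∀ z ∈ Icc (0:ℝ) 1, 1 - genFun ν (genFun q z) = lam * (1 - genFun ν z))
    {z : ℝ} (hz : z ∈ Ico (0:ℝ) 1) {t : ℝ} (ht : 0 < t) {j : ℕ}
    (hzt : 1 - genFun νm z = t * m ^ j) :
    Tendsto (fun n => (1 - genFun ν (((genFun q)^[n] 0) ^ t)) / lam ^ n) atTop
      (𝓝 ((1 - genFun ν z) / lam ^ j)) := by
  have hz' : z ∈ Icc (0:ℝ) 1 := ⟨hz.1, hz.2.le⟩
  have h0 : (0:ℝ) ∈ Icc (0:ℝ) 1 := ⟨le_rfl, zero_le_one⟩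
  have hlt := fun n => iter_lt_one hq0 hq1 hm0 hνm0 hνm00 hνm1 hH hz n
  have hlt0 := fun n => iter_lt_one hq0 hq1 hm0 hνm0 hνm00 hνm1 hH
    (z := 0) ⟨le_rfl, zero_lt_one⟩ n
  have hb : ∀ n, 1 - (genFun q)^[n] 0 ≠ 0 := fun n => by linarith [hlt0 n]
  have ha : ∀ n, 1 - (genFun q)^[n] z ≠ 0 := fun n => by linarith [hlt n]
  have hs : 0 < t * m ^ j := mul_pos ht (pow_pos hm0 j)
  set v : ℕ → ℝ := fun n => (genFun q)^[n] 0 with hv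
  have hvm : ∀ n, v n ∈ Ico (0:ℝ) 1 := fun n => ⟨(iter_mem hq0 hq1 h0 n).1, hlt0 n⟩
  have r1 := (rpow_slope hvm (iter_tendsto hq0 hq1 hm hm0 hm1 h0) t).comp (tendsto_add_atTop_nat j)
  have r2 := iter_ratio_add hq0 hq1 hm hm0 hm1 h0 hlt0 j
  have r3 := (iter_ratio hq0 hq1 hm hm0 hm1 hνm0 hνm00 hνm1 hH hz).inv₀ (by rw [hzt]; exact hs.ne')
  have r4 := (r1.mul r2).mul r3
  rw [hzt, mul_inv_cancel₀ hs.ne'] at r4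
  have r5 : Tendsto (fun n => (1 - v (n + j) ^ t) / (1 - (genFun q)^[n] z)) atTop (𝓝 1) := by
    refine r4.congr (fun n => ?_)
    simp only [Function.comp]
    have e1 := hb n
    have e2 := hb (n + j)
    have e3 := ha n
    simp only [hv]
    field_simp
  have hxm : ∀ n, v n ^ t ∈ Icc (0:ℝ) 1 := fun n =>
    ⟨Real.rpow_nonneg (hvm n).1 t, Real.rpow_le_one (hvm n).1 (hvm n).2.le ht.le⟩
  have hym : ∀ n, (genFun q)^[n] z ∈ Ico (0:ℝ) 1 := fun n =>
    ⟨(iter_mem hq0 hq1 hz' n).1, hlt n⟩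
  have hGy : ∀ n, genFun ν ((genFun q)^[n] z) < 1 := fun n =>
    (genFun_le_self hν0 hν1 hν00 ⟨(hym n).1, (hym n).2.le⟩).trans_lt (hym n).2
  have r6 : Tendsto (fun n => (1 - genFun ν (v (n + j) ^ t)) / (1 - genFun ν ((genFun q)^[n] z)))
      atTop (𝓝 1) := by
    have m1 := (tendsto_const_nhds (x := (1:ℝ))).min r5
    have m2 := (tendsto_const_nhds (x := (1:ℝ))).max r5
    simp only [min_self] at m1
    simp only [max_self] at m2
    exact tendsto_of_tendsto_of_tendsto_of_le_of_le m1 m2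
      (fun n => (ratio_bounds hν0 hν1 (hxm (n + j)) (hym n) (hGy n)).1)
      (fun n => (ratio_bounds hν0 hν1 (hxm (n + j)) (hym n) (hGy n)).2)
  rw [← tendsto_add_atTop_iff_nat j]
  have r7 := r6.mul_const ((1 - genFun ν z) / lam ^ j)
  rw [one_mul] at r7
  refine r7.congr (fun n => ?_)
  have e0 := iter_funEq hq0 hq1 hG hz' n
  have e1 : 1 - genFun ν ((genFun q)^[n] z) ≠ 0 := by linarith [hGy n]
  have e2 : 1 - genFun ν z ≠ 0 := by
    intro h; rw [h, mul_zero] at e0; exact e1 e0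
  rw [e0, pow_add]
  have := (pow_pos hlam n).ne'
  have := (pow_pos hlam j).ne'
  field_simp
  rfl

end Asymp

/-! ## The limit measure -/

section Meas

/-- continuous extension of `(1 - u^t)/(1-u)` -/
noncomputable def kerK (t : ℝ) (u : ℝ) : ℝ := dslope (fun x : ℝ => x ^ t) 1 u

lemma kerK_mul (t u : ℝ) : (1 - u) * kerK t u = 1 - u ^ t := by
  have := sub_smul_dslope (fun x : ℝ => x ^ t) 1 u
  simp only [smul_eq_mul, Real.one_rpow] at this
  unfold kerK; linarith

lemma kerK_continuous {t : ℝ} (ht : 0 < t) : Continuous (kerK t) := by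
  rw [← continuousOn_univ]
  unfold kerK
  rw [continuousOn_dslope univ_mem]
  refine ⟨(Real.continuous_rpow_const ht.le).continuousOn, ?_⟩
  exact (Real.hasDerivAt_rpow_const (Or.inl one_ne_zero)).differentiableAt

lemma kerK_one (t : ℝ) : kerK t 1 = t := by
  unfold kerK
  rw [dslope_same]
  simp

lemma kerK_zero {t : ℝ} (ht : 0 < t) : kerK t 0 = 1 := by
  have := kerK_mul t 0
  rw [Real.zero_rpow ht.ne'] at this
  linarith

lemma kerK_nonneg {t : ℝ} (ht : 0 < t) {u : ℝ} (hu : u ∈ Icc (0:ℝ) 1) : 0 ≤ kerK t u := by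
  rcases eq_or_lt_of_le hu.2 with h | h
  · rw [h, kerK_one]; exact ht.le
  · have h1 := kerK_mul t u
    have h2 : u ^ t ≤ 1 := Real.rpow_le_one hu.1 hu.2 ht.le
    by_contra hc
    push Not at hc
    nlinarith

lemma exists_limit_measure {ν : ℕ → ℝ} (hν0 : ∀ n, 0 ≤ ν n) (hν1 : HasSum ν 1)
    {v c : ℕ → ℝ} (hv : ∀ n, v n ∈ Icc (0:ℝ) 1) (hc : ∀ n, 0 < c n)
    (hvc : ∀ n, 1 - genFun ν (v n) = c n) :
    ∃ ρ : ProbabilityMeasure unitInterval, ∃ F : Filter ℕ, F ≤ atTop ∧ F.NeBot ∧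
      ∀ t : ℝ, 0 < t → Tendsto (fun n => (1 - genFun ν (v n ^ t)) / c n) F
        (𝓝 (∫ u, kerK t (u : ℝ) ∂(ρ : Measure unitInterval))) := by
  let w : ℕ → ℕ → ℝ := fun n k => ν k * (1 - v n ^ k) / c n
  have hw0 : ∀ n k, 0 ≤ w n k := fun n k =>
    div_nonneg (mul_nonneg (hν0 k) (by linarith [pow_le_one₀ (n := k) (hv n).1 (hv n).2])) (hc n).le
  have hw1 : ∀ n, HasSum (w n) 1 := by
    intro n
    have := (one_sub_genFun hν0 hν1 (hv n)).div_const (c n)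
    rwa [hvc n, div_self (hc n).ne'] at this
  let pt : ℕ → ℕ → unitInterval := fun n k =>
    ⟨v n ^ k, pow_nonneg (hv n).1 k, pow_le_one₀ (hv n).1 (hv n).2⟩
  let μ : ℕ → Measure unitInterval := fun n =>
    Measure.sum (fun k => ENNReal.ofReal (w n k) • Measure.dirac (pt n k))
  have hμ : ∀ n, IsProbabilityMeasure (μ n) := by
    intro n
    constructor
    simp only [μ]
    rw [Measure.sum_apply _ MeasurableSet.univ]
    simp only [Measure.smul_apply, measure_univ, smul_eq_mul, mul_one]
    rw [← ENNReal.ofReal_tsum_of_nonneg (hw0 n) (hw1 n).summable, (hw1 n).tsum_eq,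
      ENNReal.ofReal_one]
  let ρs : ℕ → ProbabilityMeasure unitInterval := fun n => ⟨μ n, hμ n⟩
  obtain ⟨ρ, -, hρ⟩ := (isCompact_univ (X := ProbabilityMeasure unitInterval)).ultrafilter_le_nhds
    ((hyperfilter ℕ).map ρs) (by simp)
  have hT : Tendsto ρs (hyperfilter ℕ : Filter ℕ) (𝓝 ρ) := hρ
  refine ⟨ρ, (hyperfilter ℕ : Filter ℕ), ?_, inferInstance, ?_⟩
  · exact Nat.hyperfilter_le_atTop
  intro t ht
  rw [ProbabilityMeasure.tendsto_iff_forall_integral_tendsto] at hT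
  have hcont : Continuous (fun u : unitInterval => kerK t (u : ℝ)) :=
    (kerK_continuous ht).comp continuous_subtype_val
  have h1 := hT (BoundedContinuousFunction.mkOfCompact ⟨_, hcont⟩)
  simp only [BoundedContinuousFunction.mkOfCompact_apply, ContinuousMap.coe_mk] at h1
  refine h1.congr (fun n => ?_)
  change ∫ u, kerK t (u : ℝ) ∂(μ n) = _
  have hIntg : Integrable (fun u : unitInterval => kerK t (u : ℝ)) (μ n) :=
    (BoundedContinuousFunction.mkOfCompact ⟨_, hcont⟩).integrable (μ n)
  have h2 := hasSum_integral_measure hIntg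
  have hvt : v n ^ t ∈ Icc (0:ℝ) 1 :=
    ⟨Real.rpow_nonneg (hv n).1 t, Real.rpow_le_one (hv n).1 (hv n).2 ht.le⟩
  have h3 := (one_sub_genFun hν0 hν1 hvt).div_const (c n)
  refine h2.unique (hasSum_congr_aux (fun k => ?_) h3)
  rw [integral_smul_measure, integral_dirac, ENNReal.toReal_ofReal (hw0 n k)]
  simp only [w, pt, smul_eq_mul]
  have e1 := kerK_mul t (v n ^ k)
  have e2 : (v n ^ k) ^ t = (v n ^ t) ^ k := by
    rw [← Real.rpow_natCast, ← Real.rpow_mul (hv n).1, mul_comm, Real.rpow_mul (hv n).1,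
      Real.rpow_natCast]
  rw [← e2, ← e1]; ring

lemma kerK_integrable (ρ : Measure unitInterval) [IsFiniteMeasure ρ] {t : ℝ} (ht : 0 < t) :
    Integrable (fun u : unitInterval => kerK t (u : ℝ)) ρ := by
  have hcont : Continuous (fun u : unitInterval => kerK t (u : ℝ)) :=
    (kerK_continuous ht).comp continuous_subtype_val
  exact (BoundedContinuousFunction.mkOfCompact ⟨_, hcont⟩).integrable ρ

lemma kerK_singleton (ρ : Measure unitInterval) [IsFiniteMeasure ρ] {t : ℝ} (ht : 0 < t)
    (u : unitInterval) : kerK t u * ρ.real {u} ≤ ∫ u, kerK t (u : ℝ) ∂ρ := by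
  have h1 : ∫ u in {u}, kerK t (u : ℝ) ∂ρ ≤ ∫ u, kerK t (u : ℝ) ∂ρ :=
    setIntegral_le_integral (kerK_integrable ρ ht)
      (Eventually.of_forall (fun x => kerK_nonneg ht x.2))
  rw [integral_singleton] at h1
  rw [mul_comm]; simpa using h1

/-- Pushing forward to the half line. -/
lemma exists_sigma (ρ : Measure unitInterval) [IsProbabilityMeasure ρ]
    (h0 : ρ {0} = 0) (h1 : ρ {1} = 0) :
    ∃ σ : Measure ℝ, IsProbabilityMeasure σ ∧ σ (Iic 0) = 0 ∧
      ∀ t : ℝ, 0 < t → Integrable (fun x => (1 - exp (-(t * x))) / (1 - exp (-x))) σ ∧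
        ∫ x, (1 - exp (-(t * x))) / (1 - exp (-x)) ∂σ = ∫ u, kerK t (u : ℝ) ∂ρ := by
  have hX : Measurable (fun u : unitInterval => - Real.log (u : ℝ)) := by fun_prop
  have hae : ∀ᵐ u : unitInterval ∂ρ, (u : ℝ) ∈ Ioo (0:ℝ) 1 := by
    rw [ae_iff]
    refine measure_mono_null (t := {0} ∪ {1}) ?_ (measure_union_null h0 h1)
    intro u hu
    simp only [mem_setOf_eq, mem_Ioo, not_and_or, not_lt] at hu
    rcases hu with hu | hu
    · left; exact Subtype.ext (le_antisymm hu u.2.1)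
    · right; exact Subtype.ext (le_antisymm u.2.2 hu)
  refine ⟨ρ.map (fun u : unitInterval => - Real.log (u : ℝ)),
    Measure.isProbabilityMeasure_map hX.aemeasurable, ?_, ?_⟩
  · rw [Measure.map_apply hX measurableSet_Iic]
    refine measure_mono_null ?_ (ae_iff.1 hae)
    intro u hu
    simp only [mem_preimage, mem_Iic, Left.neg_nonpos_iff] at hu
    simp only [mem_setOf_eq]
    intro hu'
    exact absurd (Real.log_neg hu'.1 hu'.2) (not_lt.2 hu)
  · intro t ht
    have hm : Measurable (fun x : ℝ => (1 - exp (-(t * x))) / (1 - exp (-x))) := by fun_prop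
    have hcongr : (fun u : unitInterval => kerK t (u : ℝ)) =ᵐ[ρ]
        (fun x : ℝ => (1 - exp (-(t * x))) / (1 - exp (-x))) ∘
          (fun u : unitInterval => - Real.log (u : ℝ)) := by
      filter_upwards [hae] with u hu
      have e1 := kerK_mul t u
      have e2 : exp (-(t * -Real.log (u:ℝ))) = (u:ℝ) ^ t := by
        rw [Real.rpow_def_of_pos hu.1]; congr 1; ring
      simp only [Function.comp, e2, neg_neg, Real.exp_log hu.1]
      rw [← e1, mul_div_cancel_left₀]
      linarith [hu.2]
    constructor
    · rw [integrable_map_measure hm.aestronglyMeasurable hX.aemeasurable]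
      exact (kerK_integrable ρ ht).congr hcongr
    · rw [integral_map hX.aemeasurable hm.aestronglyMeasurable]
      exact (integral_congr_ae hcongr).symm

lemma unit_measure_ext (μ μ' : Measure unitInterval) [IsFiniteMeasure μ] [IsFiniteMeasure μ']
    (h : ∀ N : ℕ, ∫ u, (u : ℝ) ^ N ∂μ = ∫ u, (u : ℝ) ^ N ∂μ') : μ = μ' := by
  have hci : ∀ (ρ : Measure unitInterval) [IsFiniteMeasure ρ] (g : unitInterval → ℝ),
      Continuous g → Integrable g ρ := by
    intro ρ _ g hg
    exact (BoundedContinuousFunction.mkOfCompact ⟨_, hg⟩).integrable ρ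
  have hpoly : ∀ p : Polynomial ℝ, ∫ u : unitInterval, p.eval (u : ℝ) ∂μ
      = ∫ u : unitInterval, p.eval (u : ℝ) ∂μ' := by
    intro p
    simp_rw [Polynomial.eval_eq_sum_range]
    rw [integral_finsetSum, integral_finsetSum]
    · apply Finset.sum_congr rfl
      intro i _
      rw [integral_const_mul, integral_const_mul, h i]
    · intro i _; exact hci _ _ (by fun_prop)
    · intro i _; exact hci _ _ (by fun_prop)
  apply ext_of_forall_integral_eq_of_IsFiniteMeasure
  intro f
  have hb : ∀ (ρ : Measure unitInterval) [IsFiniteMeasure ρ] (ε : ℝ) (p : Polynomial ℝ),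
      ‖p.toContinuousMapOn (Icc (0:ℝ) 1) - f.toContinuousMap‖ < ε →
      |∫ u : unitInterval, p.eval (u:ℝ) ∂ρ - ∫ u, f u ∂ρ| ≤ ε * ρ.real univ := by
    intro ρ _ ε p hp
    rw [← integral_sub (hci _ _ (by fun_prop)) (hci _ _ f.continuous)]
    have := norm_integral_le_of_norm_le_const (μ := ρ) (C := ε)
      (f := fun u : unitInterval => p.eval (u:ℝ) - f u) (Eventually.of_forall (fun u => ?_))
    · simpa using this
    · have := (p.toContinuousMapOn (Icc (0:ℝ) 1) - f.toContinuousMap).norm_coe_le_norm u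
      exact this.trans hp.le
  have hC : 0 ≤ μ.real univ + μ'.real univ := by positivity
  have : ∀ ε > 0, |∫ u, f u ∂μ - ∫ u, f u ∂μ'| ≤ ε := by
    intro ε hε
    obtain ⟨p, hp⟩ := exists_polynomial_near_continuousMap 0 1 f.toContinuousMap
      (ε / (μ.real univ + μ'.real univ + 1)) (by positivity)
    have a1 := hb μ _ p hp
    have a2 := hb μ' _ p hp
    rw [hpoly p] at a1
    have a3 : ε / (μ.real univ + μ'.real univ + 1) * μ.real univ
        + ε / (μ.real univ + μ'.real univ + 1) * μ'.real univ ≤ ε := by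
      rw [← mul_add, div_mul_eq_mul_div, div_le_iff₀ (by positivity)]
      nlinarith
    rw [abs_le] at *
    constructor <;> linarith [a1.1, a1.2, a2.1, a2.2]
  have h2 := le_of_forall_pos_le_add (a := |∫ u, f u ∂μ - ∫ u, f u ∂μ'|) (b := 0)
    (fun ε hε => by simpa using this ε hε)
  linarith [abs_nonpos_iff.1 h2]

lemma laplace_ext (σ σ' : Measure ℝ) [IsFiniteMeasure σ] [IsFiniteMeasure σ']
    (h0 : σ (Iic 0) = 0) (h0' : σ' (Iic 0) = 0)
    (h : ∀ N : ℕ, ∫ x, exp (-(N * x)) ∂σ = ∫ x, exp (-(N * x)) ∂σ') : σ = σ' := by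
  let e : ℝ → unitInterval := fun x => projIcc 0 1 zero_le_one (exp (-x))
  have he : Measurable e := (continuous_projIcc.comp (by fun_prop)).measurable
  have he2 : ∀ x : ℝ, 0 < x → (e x : ℝ) = exp (-x) := by
    intro x hx
    simp only [e]
    rw [projIcc_of_mem]
    exact ⟨(exp_pos _).le, by simpa using hx.le⟩
  have hl : Measurable (fun u : unitInterval => - Real.log (u : ℝ)) := by fun_prop
  have hae : ∀ (τ : Measure ℝ), τ (Iic 0) = 0 → ∀ᵐ x ∂τ, 0 < x := by
    intro τ hτ
    rw [ae_iff]
    simp only [not_lt]; exact hτ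
  have key : σ.map e = σ'.map e := by
    have : IsFiniteMeasure (σ.map e) := Measure.isFiniteMeasure_map σ e
    have : IsFiniteMeasure (σ'.map e) := Measure.isFiniteMeasure_map σ' e
    apply unit_measure_ext
    have hh : ∀ (τ : Measure ℝ), τ (Iic 0) = 0 → ∀ N : ℕ, ∫ u, (u : ℝ) ^ N ∂(τ.map e)
        = ∫ x, exp (-(N * x)) ∂τ := by
      intro τ hτ N
      rw [integral_map he.aemeasurable (by fun_prop)]
      apply integral_congr_ae
      filter_upwards [hae τ hτ] with x hx
      rw [he2 x hx, ← Real.exp_nat_mul]; congr 1; ring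
    intro N
    rw [hh σ h0, hh σ' h0', h]
  have back : ∀ (τ : Measure ℝ), τ (Iic 0) = 0 →
      (τ.map e).map (fun u : unitInterval => - Real.log (u : ℝ)) = τ := by
    intro τ hτ
    rw [Measure.map_map hl he]
    conv_rhs => rw [← Measure.map_id (μ := τ)]
    apply Measure.map_congr
    filter_upwards [hae τ hτ] with x hx
    simp only [Function.comp, he2 x hx, Real.log_exp, neg_neg, id]
  rw [← back σ h0, key, back σ' h0']

end Meas

/-! ## Construction of `Λ` -/

section Lam

/-- density of `Λ` -/
noncomputable def densL (α x : ℝ) : ℝ := x ^ α / (1 - exp (-x))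

/-- kernel on the half line -/
noncomputable def kerL (t x : ℝ) : ℝ := (1 - exp (-(t * x))) / (1 - exp (-x))

lemma one_sub_exp_pos {x : ℝ} (hx : 0 < x) : 0 < 1 - exp (-x) := by
  have : exp (-x) < 1 := by simpa using hx
  linarith

lemma densL_nonneg {α x : ℝ} (hx : 0 < x) : 0 ≤ densL α x :=
  div_nonneg (Real.rpow_nonneg hx.le _) (one_sub_exp_pos hx).le

lemma densL_measurable (α : ℝ) : Measurable (densL α) := by unfold densL; fun_prop

lemma kerL_measurable (t : ℝ) : Measurable (kerL t) := by unfold kerL; fun_prop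

lemma kerL_nonneg {t x : ℝ} (ht : 0 ≤ t) (hx : 0 < x) : 0 ≤ kerL t x := by
  refine div_nonneg ?_ (one_sub_exp_pos hx).le
  have : exp (-(t * x)) ≤ 1 := by simpa using mul_nonneg ht hx.le
  linarith

lemma ae_pos_of {σ : Measure ℝ} (h0 : σ (Iic 0) = 0) : ∀ᵐ x ∂σ, 0 < x := by
  rw [ae_iff]; simp only [not_lt]; exact h0

lemma lam_integral {σ : Measure ℝ} (h0 : σ (Iic 0) = 0) (α : ℝ) (g : ℝ → ℝ) :
    ∫ x in Ioi (0:ℝ), g x ∂(σ.withDensity (fun x => ENNReal.ofReal (densL α x)))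
      = ∫ x, densL α x * g x ∂σ := by
  have h1 : (σ.withDensity (fun x => ENNReal.ofReal (densL α x))) (Iic 0) = 0 :=
    withDensity_absolutelyContinuous _ _ h0
  rw [Measure.restrict_eq_self_of_ae_mem (s := Ioi (0:ℝ)) (ae_pos_of h1)]
  rw [integral_withDensity_eq_integral_toReal_smul
    (densL_measurable α).ennreal_ofReal (by simp)]
  apply integral_congr_ae
  filter_upwards [ae_pos_of h0] with x hx
  rw [ENNReal.toReal_ofReal (densL_nonneg hx), smul_eq_mul]

lemma lam_locFinite {σ : Measure ℝ} [IsFiniteMeasure σ] (h0 : σ (Iic 0) = 0) (α : ℝ) :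
    IsLocFiniteOnPos (σ.withDensity (fun x => ENNReal.ofReal (densL α x))) := by
  refine ⟨withDensity_absolutelyContinuous _ _ h0, fun K hK hKpos => ?_⟩
  rw [withDensity_apply _ hK.measurableSet]
  have hc : ContinuousOn (densL α) K := by
    unfold densL
    apply ContinuousOn.div
    · exact continuousOn_id.rpow_const (fun x hx => Or.inl (hKpos hx).ne')
    · fun_prop
    · intro x hx; exact (one_sub_exp_pos (hKpos hx)).ne'
  obtain ⟨C, hC⟩ := hK.exists_bound_of_continuousOn hc
  refine lt_of_le_of_lt (setLIntegral_mono (g := fun _ => ENNReal.ofReal C) measurable_const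
    (fun x hx => ENNReal.ofReal_le_ofReal ((le_abs_self _).trans (hC x hx)))) ?_
  rw [setLIntegral_const]
  exact ENNReal.mul_lt_top ENNReal.ofReal_lt_top (measure_lt_top _ _)

lemma kerL_diff {t s x : ℝ} :
    kerL s x - kerL t x = (exp (-(t * x)) - exp (-(s * x))) / (1 - exp (-x)) := by
  unfold kerL
  rw [← sub_div]; congr 1; ring

lemma image_mul_eq {m : ℝ} (hm0 : 0 < m) (A : Set ℝ) :
    (fun x => m * x) '' A = (fun x => m⁻¹ * x) ⁻¹' A := by
  ext y
  constructor
  · rintro ⟨x, hx, rfl⟩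
    simp only [mem_preimage]
    rwa [inv_mul_cancel_left₀ hm0.ne']
  · intro hy
    exact ⟨m⁻¹ * y, hy, mul_inv_cancel_left₀ hm0.ne' y⟩

lemma lam_scale {σ : Measure ℝ} [IsFiniteMeasure σ] (h0 : σ (Iic 0) = 0) {m α : ℝ} (hm0 : 0 < m)
    (hk : ∀ t, 0 ≤ t → Integrable (kerL t) σ)
    (hs : ∀ t, 0 ≤ t → ∫ x, kerL (m * t) x ∂σ = m ^ α * ∫ x, kerL t x ∂σ) :
    ScaleInvariant m (σ.withDensity (fun x => ENNReal.ofReal (densL α x))) := by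
  have hmi : 0 < m⁻¹ := inv_pos.2 hm0
  have hma : 0 < m ^ α := Real.rpow_pos_of_pos hm0 α
  set w : ℝ → ℝ := fun x => m ^ α * kerL m⁻¹ x with hw
  have hwm : Measurable w := (kerL_measurable _).const_mul _
  have hwi : Integrable w σ := (hk _ hmi.le).const_mul _
  have hw0 : ∀ x, 0 < x → 0 ≤ w x := fun x hx => mul_nonneg hma.le (kerL_nonneg hmi.le hx)
  have hM : Measurable (fun x : ℝ => m⁻¹ * x) := by fun_prop
  set τ : Measure ℝ := σ.withDensity (fun x => ENNReal.ofReal (w x)) with hτ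
  have : IsFiniteMeasure τ := isFiniteMeasure_withDensity_ofReal hwi.2
  have hτ0 : τ (Iic 0) = 0 := withDensity_absolutelyContinuous _ _ h0
  have heq : τ.map (fun x : ℝ => m⁻¹ * x) = σ := by
    have : IsFiniteMeasure (τ.map (fun x : ℝ => m⁻¹ * x)) := Measure.isFiniteMeasure_map _ _
    apply laplace_ext _ _ _ h0
    · intro N
      rw [integral_map hM.aemeasurable (by fun_prop)]
      rw [hτ, integral_withDensity_eq_integral_toReal_smul hwm.ennreal_ofReal (by simp)]
      have e1 : ∫ x, (ENNReal.ofReal (w x)).toReal • exp (-(N * (m⁻¹ * x))) ∂σ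
          = ∫ x, m ^ α * (kerL (m⁻¹ * (N + 1)) x - kerL (m⁻¹ * N) x) ∂σ := by
        apply integral_congr_ae
        filter_upwards [ae_pos_of h0] with x hx
        rw [ENNReal.toReal_ofReal (hw0 x hx), smul_eq_mul, kerL_diff, hw]
        simp only [kerL]
        have : exp (-(m⁻¹ * (N + 1) * x)) = exp (-(N * (m⁻¹ * x))) * exp (-(m⁻¹ * x)) := by
          rw [← Real.exp_add]; congr 1; ring
        rw [this, show m⁻¹ * (N:ℝ) * x = N * (m⁻¹ * x) by ring]
        ring
      have e2 : ∫ x, exp (-(N * x)) ∂σ = ∫ x, (kerL ((N:ℝ) + 1) x - kerL N x) ∂σ := by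
        apply integral_congr_ae
        filter_upwards [ae_pos_of h0] with x hx
        rw [kerL_diff]
        have : exp (-(((N:ℝ) + 1) * x)) = exp (-(N * x)) * exp (-x) := by
          rw [← Real.exp_add]; congr 1; ring
        rw [this, eq_div_iff (one_sub_exp_pos hx).ne']; ring
      rw [e1, e2, integral_const_mul, integral_sub (hk _ (by positivity)) (hk _ (by positivity)),
        integral_sub (hk _ (by positivity)) (hk _ (by positivity)), mul_sub,
        ← hs _ (by positivity), ← hs _ (by positivity), mul_inv_cancel_left₀ hm0.ne',
        mul_inv_cancel_left₀ hm0.ne']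
    · rw [Measure.map_apply hM measurableSet_Iic]
      convert hτ0 using 2
      ext x
      simp only [mem_preimage, mem_Iic]
      constructor
      · intro h; by_contra hc; push Not at hc; linarith [mul_pos hmi hc]
      · intro h; exact mul_nonpos_of_nonneg_of_nonpos hmi.le h
  intro A hA hApos
  rw [image_mul_eq hm0, withDensity_apply _ hA, withDensity_apply _ (hM hA)]
  conv_lhs => rw [← heq]
  have hdm : Measurable (fun x => ENNReal.ofReal (densL α (m⁻¹ * x))) :=
    ((densL_measurable α).comp hM).ennreal_ofReal
  rw [setLIntegral_map hA (densL_measurable α).ennreal_ofReal hM]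
  rw [hτ, setLIntegral_withDensity_eq_setLIntegral_mul _ hwm.ennreal_ofReal
    hdm (hM hA)]
  apply setLIntegral_congr_fun (hM hA)
  intro x hx
  have hx' : 0 < m⁻¹ * x := hApos hx
  have hx0 : 0 < x := by
    by_contra hc; push Not at hc
    linarith [mul_nonpos_of_nonneg_of_nonpos hmi.le hc]
  simp only [Pi.mul_apply, Function.comp]
  rw [← ENNReal.ofReal_mul (hw0 x hx0)]
  congr 1
  simp only [hw, kerL, densL]
  rw [Real.mul_rpow hmi.le hx0.le, Real.inv_rpow hm0.le]
  have a1 := (one_sub_exp_pos hx0).ne'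
  have a2 := (one_sub_exp_pos hx').ne'
  rw [show m⁻¹ * x = x / m by ring] at a2 ⊢
  field_simp

end Lam

/-! ## The two directions -/

lemma scale_map {m : ℝ} (hm0 : 0 < m) {Λ : Measure ℝ} (hΛ : ScaleInvariant m Λ) :
    (Λ.restrict (Ioi 0)).map (fun x => m * x) = Λ.restrict (Ioi 0) := by
  have hM : Measurable (fun x : ℝ => m * x) := by fun_prop
  ext B hB
  rw [Measure.map_apply hM hB, Measure.restrict_apply (hM hB), Measure.restrict_apply hB,
    hΛ _ ((hM hB).inter measurableSet_Ioi) inter_subset_right]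
  congr 1
  ext y
  constructor
  · rintro ⟨x, ⟨hx1, hx2⟩, rfl⟩
    exact ⟨hx1, mul_pos hm0 hx2⟩
  · rintro ⟨hy1, hy2⟩
    refine ⟨m⁻¹ * y, ⟨?_, mul_pos (inv_pos.2 hm0) hy2⟩, mul_inv_cancel_left₀ hm0.ne' y⟩
    simp only [mem_preimage]
    rwa [mul_inv_cancel_left₀ hm0.ne']

lemma backward
    (q : ℕ → ℝ) (hq0 : ∀ k, 0 ≤ q k) (hq1 : HasSum q 1)
    (m : ℝ) (hm : HasSum (fun k : ℕ => (k : ℝ) * q k) m) (hm0 : 0 < m) (hm1 : m < 1)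
    (νmin : ℕ → ℝ) (hmin : IsInvMeasure q m νmin) (hmin1 : HasSum νmin 1)
    (α : ℝ)
    (ν : ℕ → ℝ) (hν0 : ∀ n, 0 ≤ ν n) (hν00 : ν 0 = 0) (hν1 : HasSum ν 1)
    (Λ : Measure ℝ) (hΛ : ScaleInvariant m Λ)
    (h1 : (∫ x in Set.Ioi (0 : ℝ), (1 - Real.exp (-x)) * x ^ (-α) ∂Λ) = 1)
    (hgf : ∀ z ∈ Set.Ioo (0 : ℝ) 1, genFun ν z = ∫ x in Set.Ioi (0 : ℝ),
      (Real.exp ((genFun νmin z - 1) * x) - Real.exp (-x)) * x ^ (-α) ∂Λ) :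
    IsInvMeasure q (m ^ α) ν := by
  have hH := fun z (hz : z ∈ Icc (0:ℝ) 1) => funEq_of_inv hq0 hq1 hmin hmin1 hz
  have hma : 0 < m ^ α := Real.rpow_pos_of_pos hm0 α
  apply inv_of_funEq hq0 hq1 hν0 hν00 hν1
  let I : ℝ → ℝ := fun t => ∫ x in Ioi (0:ℝ), (1 - exp (-(t * x))) * x ^ (-α) ∂Λ
  have hint1 : IntegrableOn (fun x : ℝ => (1 - exp (-x)) * x ^ (-α)) (Ioi 0) Λ := by
    by_contra hc
    rw [integral_undef hc] at h1
    exact zero_ne_one h1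
  have hIntg : ∀ t ∈ Icc (0:ℝ) 1,
      IntegrableOn (fun x : ℝ => (1 - exp (-(t * x))) * x ^ (-α)) (Ioi 0) Λ := by
    intro t ht
    refine Integrable.mono' hint1 (Measurable.aestronglyMeasurable (by fun_prop)) ?_
    filter_upwards [ae_restrict_mem measurableSet_Ioi] with x hx
    have hx' : 0 < x := hx
    have e1 : exp (-(t * x)) ≤ 1 := by simpa using mul_nonneg ht.1 hx'.le
    have e2 : exp (-x) ≤ exp (-(t * x)) := by
      apply Real.exp_le_exp.2; nlinarith [ht.2]
    have e3 : 0 ≤ x ^ (-α) := Real.rpow_nonneg hx'.le _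
    rw [Real.norm_of_nonneg (mul_nonneg (by linarith) e3)]
    exact mul_le_mul_of_nonneg_right (by linarith) e3
  have hI : ∀ z ∈ Ioo (0:ℝ) 1, 1 - genFun ν z = I (1 - genFun νmin z) := by
    intro z hz
    have hz' : z ∈ Icc (0:ℝ) 1 := ⟨hz.1.le, hz.2.le⟩
    have hh := genFun_mem hmin.1 hmin1 hz'
    have ht : 1 - genFun νmin z ∈ Icc (0:ℝ) 1 := ⟨by linarith [hh.2], by linarith [hh.1]⟩
    have e0 : genFun ν z = (∫ x in Ioi (0:ℝ), (1 - exp (-x)) * x ^ (-α) ∂Λ)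
        - I (1 - genFun νmin z) := by
      rw [hgf z hz]
      simp only [I]
      rw [← integral_sub hint1 (hIntg _ ht)]
      apply integral_congr_ae
      refine Eventually.of_forall (fun x => ?_)
      simp only
      rw [show (genFun νmin z - 1) * x = -((1 - genFun νmin z) * x) by ring]
      ring
    rw [e0, h1]
    ring
  have hIs : ∀ t, I (m * t) = m ^ α * I t := by
    intro t
    have hM : Measurable (fun x : ℝ => m * x) := by fun_prop
    have e1 : I t = ∫ x in Ioi (0:ℝ), m ^ (-α) * ((1 - exp (-(m * t * x))) * x ^ (-α)) ∂Λ := by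
      simp only [I]
      conv_lhs => rw [← scale_map hm0 hΛ]
      rw [integral_map hM.aemeasurable (Measurable.aestronglyMeasurable (by fun_prop))]
      apply setIntegral_congr_fun measurableSet_Ioi
      intro x hx
      simp only
      rw [Real.mul_rpow hm0.le (le_of_lt hx), show t * (m * x) = m * t * x by ring]
      ring
    rw [e1, integral_const_mul, ← mul_assoc, ← Real.rpow_add hm0]
    simp [I]
  intro z hz
  have hz' : z ∈ Icc (0:ℝ) 1 := ⟨hz.1.le, hz.2.le⟩
  have hfz : genFun q z ∈ Ioo (0:ℝ) 1 := by
    constructor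
    · have := one_sub_genFun_le hq0 hq1 hm hz'
      nlinarith [hz.1, hz.2]
    · have := iter_lt_one hq0 hq1 hm0 hmin.1 hmin.2.1 hmin1 hH ⟨hz.1.le, hz.2⟩ 1
      simpa using this
  rw [hI _ hfz, hH z hz', hIs, hI z hz]

lemma forward
    (q : ℕ → ℝ) (hq0 : ∀ k, 0 ≤ q k) (hq1 : HasSum q 1)
    (m : ℝ) (hm : HasSum (fun k : ℕ => (k : ℝ) * q k) m) (hm0 : 0 < m) (hm1 : m < 1)
    (νmin : ℕ → ℝ) (hmin : IsInvMeasure q m νmin) (hmin1 : HasSum νmin 1)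
    (α : ℝ) (hα : α ∈ Set.Ioo (0 : ℝ) 1)
    (ν : ℕ → ℝ) (hν1 : HasSum ν 1) (hinv : IsInvMeasure q (m ^ α) ν) :
    ∃ Λ : Measure ℝ, IsLocFiniteOnPos Λ ∧ ScaleInvariant m Λ ∧
        (∫ x in Set.Ioi (0 : ℝ), (1 - Real.exp (-x)) * x ^ (-α) ∂Λ) = 1 ∧
        ∀ z ∈ Set.Ioo (0 : ℝ) 1, genFun ν z = ∫ x in Set.Ioi (0 : ℝ),
              (Real.exp ((genFun νmin z - 1) * x) - Real.exp (-x)) * x ^ (-α) ∂Λ := by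
  have hH := fun z (hz : z ∈ Icc (0:ℝ) 1) => funEq_of_inv hq0 hq1 hmin hmin1 hz
  have hG := fun z (hz : z ∈ Icc (0:ℝ) 1) => funEq_of_inv hq0 hq1 hinv hν1 hz
  obtain ⟨hν0, hν00, -⟩ := hinv
  obtain ⟨hνm0, hνm00, -⟩ := hmin
  set lam : ℝ := m ^ α with hlamdef
  have hlam : 0 < lam := Real.rpow_pos_of_pos hm0 α
  have hlam1 : lam < 1 := Real.rpow_lt_one hm0.le hm1 hα.1
  have hmlam : m < lam := by
    have := Real.rpow_lt_rpow_of_exponent_gt hm0 hm1 hα.2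
    rwa [Real.rpow_one] at this
  have h0 : (0:ℝ) ∈ Icc (0:ℝ) 1 := ⟨le_rfl, zero_le_one⟩
  have hlt0 := fun n => iter_lt_one hq0 hq1 hm0 hνm0 hνm00 hmin1 hH
    (z := 0) ⟨le_rfl, zero_lt_one⟩ n
  have hGv : ∀ n, 1 - genFun ν ((genFun q)^[n] 0) = lam ^ n := by
    intro n; rw [iter_funEq hq0 hq1 hG h0, genFun_zero, hν00]; ring
  have hHv : ∀ n, 1 - genFun νmin ((genFun q)^[n] 0) = m ^ n := by
    intro n; rw [iter_funEq hq0 hq1 hH h0, genFun_zero, hνm00]; ring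
  obtain ⟨ρ, F, hF, hFne, hρ⟩ := exists_limit_measure hν0 hν1 (v := fun n => (genFun q)^[n] 0)
    (c := fun n => lam ^ n) (fun n => iter_mem hq0 hq1 h0 n) (fun n => pow_pos hlam n) hGv
  set Φ : ℝ → ℝ := fun t => ∫ u, kerK t (u : ℝ) ∂(ρ : Measure unitInterval) with hΦdef
  have hΦ : ∀ (t : ℝ), 0 < t → ∀ (z : ℝ), z ∈ Ico (0:ℝ) 1 → ∀ j : ℕ,
      1 - genFun νmin z = t * m ^ j → Φ t = (1 - genFun ν z) / lam ^ j := by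
    intro t ht z hz j hzt
    have l1 := (main_limit hq0 hq1 hm hm0 hm1 hνm0 hνm00 hmin1 hH hν0 hν00 hν1 hlam hG hz ht
      hzt).mono_left hF
    exact tendsto_nhds_unique (hρ t ht) l1
  have hΦscale : ∀ t, 0 < t → Φ (m * t) = lam * Φ t := by
    intro t ht
    obtain ⟨j, hj⟩ : ∃ j : ℕ, t * m ^ (j + 1) < 1 := by
      have := ((tendsto_pow_atTop_nhds_zero_of_lt_one hm0.le hm1).comp
        (tendsto_add_atTop_nat 1)).const_mul t
      rw [mul_zero] at this
      exact (this.eventually (gt_mem_nhds zero_lt_one)).exists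
    have hpos : 0 < t * m ^ (j + 1) := by positivity
    obtain ⟨z, hz, hzt⟩ : ∃ z ∈ Icc (0:ℝ) 1, genFun νmin z = 1 - t * m ^ (j + 1) := by
      have := intermediate_value_Icc zero_le_one (genFun_continuousOn hνm0 hmin1)
      rw [genFun_zero, hνm00, genFun_one hmin1] at this
      exact this ⟨by linarith, by linarith⟩
    have hz1 : z < 1 := by
      refine lt_of_le_of_ne hz.2 (fun he => ?_)
      rw [he, genFun_one hmin1] at hzt
      linarith
    rw [hΦ t ht z ⟨hz.1, hz1⟩ (j + 1) (by linarith),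
      hΦ (m * t) (by positivity) z ⟨hz.1, hz1⟩ j (by rw [hzt]; ring)]
    rw [pow_succ]; field_simp
  have hρ0 : (ρ : Measure unitInterval) {0} = 0 := by
    rw [← measureReal_eq_zero_iff]
    refine le_antisymm ?_ measureReal_nonneg
    refine ge_of_tendsto' (tendsto_pow_atTop_nhds_zero_of_lt_one hlam.le hlam1) (fun n => ?_)
    have := kerK_singleton (ρ : Measure unitInterval) (pow_pos hm0 n) 0
    have e := hΦ (m ^ n) (pow_pos hm0 n) ((genFun q)^[n] 0) ⟨(iter_mem hq0 hq1 h0 n).1, hlt0 n⟩ 0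
      (by rw [hHv]; simp)
    rw [hGv, pow_zero, div_one] at e
    rw [← e]
    rwa [show ((0 : unitInterval) : ℝ) = 0 from rfl, kerK_zero (pow_pos hm0 n), one_mul] at this
  have hρ1 : (ρ : Measure unitInterval) {1} = 0 := by
    rw [← measureReal_eq_zero_iff]
    refine le_antisymm ?_ measureReal_nonneg
    refine ge_of_tendsto' (tendsto_pow_atTop_nhds_zero_of_lt_one (r := m / lam) (by positivity)
      (by rwa [div_lt_one hlam])) (fun n => ?_)
    have hmn : 0 < (m ^ n)⁻¹ := by positivity
    have := kerK_singleton (ρ : Measure unitInterval) hmn 1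
    have e := hΦ (m ^ n)⁻¹ hmn 0 ⟨le_rfl, zero_lt_one⟩ n
      (by rw [genFun_zero, hνm00, inv_mul_cancel₀ (pow_pos hm0 n).ne', sub_zero])
    rw [genFun_zero, hν00, sub_zero] at e
    rw [show ((1 : unitInterval) : ℝ) = 1 from rfl, kerK_one] at this
    change _ ≤ Φ _ at this
    rw [e, inv_mul_le_iff₀ (pow_pos hm0 n)] at this
    rw [div_pow]
    calc _ ≤ _ := this
      _ = _ := by ring
  obtain ⟨σ, hσp, hσ0, hσ⟩ := exists_sigma (ρ : Measure unitInterval) hρ0 hρ1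
  have hk : ∀ t, 0 ≤ t → Integrable (kerL t) σ := by
    intro t ht
    rcases eq_or_lt_of_le ht with h | h
    · have : kerL t = fun _ => 0 := by ext x; simp [kerL, ← h]
      rw [this]; exact integrable_zero _ _ _
    · exact (hσ t h).1
  have hkΦ : ∀ t, 0 < t → ∫ x, kerL t x ∂σ = Φ t := fun t ht => (hσ t ht).2
  have hs : ∀ t, 0 ≤ t → ∫ x, kerL (m * t) x ∂σ = m ^ α * ∫ x, kerL t x ∂σ := by
    intro t ht
    rcases eq_or_lt_of_le ht with h | h
    · simp [kerL, ← h]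
    · rw [hkΦ t h, hkΦ _ (by positivity), hΦscale t h]
  refine ⟨_, lam_locFinite hσ0 α, lam_scale hσ0 hm0 hk hs, ?_, ?_⟩
  · rw [lam_integral hσ0]
    have : ∫ x, densL α x * ((1 - exp (-x)) * x ^ (-α)) ∂σ = ∫ x, (1:ℝ) ∂σ := by
      apply integral_congr_ae
      filter_upwards [ae_pos_of hσ0] with x hx
      have a1 := (one_sub_exp_pos hx).ne'
      have a2 := (Real.rpow_pos_of_pos hx α).ne'
      rw [densL, Real.rpow_neg hx.le]
      field_simp
    rw [this]; simp
  · intro z hz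
    have hz' : z ∈ Icc (0:ℝ) 1 := ⟨hz.1.le, hz.2.le⟩
    have ht : 0 < 1 - genFun νmin z := by
      linarith [genFun_le_self hνm0 hmin1 hνm00 hz', hz.2]
    rw [lam_integral hσ0]
    have e : ∫ x, densL α x * ((exp ((genFun νmin z - 1) * x) - exp (-x)) * x ^ (-α)) ∂σ
        = ∫ x, (1 - kerL (1 - genFun νmin z) x) ∂σ := by
      apply integral_congr_ae
      filter_upwards [ae_pos_of hσ0] with x hx
      have a1 := (one_sub_exp_pos hx).ne'
      have a2 := (Real.rpow_pos_of_pos hx α).ne'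
      simp only [kerL]
      rw [densL, Real.rpow_neg hx.le, 
        show (genFun νmin z - 1) * x = -((1 - genFun νmin z) * x) by ring]
      field_simp
      ring
    rw [e, integral_sub (integrable_const _) (hk _ ht.le), hkΦ _ ht,
      hΦ _ ht z ⟨hz.1.le, hz.2⟩ 0 (by simp)]
    simp

theorem qsd_characterization
    (q : ℕ → ℝ) (hq0 : ∀ k, 0 ≤ q k) (hq1 : HasSum q 1)
    (m : ℝ) (hm : HasSum (fun k : ℕ => (k : ℝ) * q k) m) (hm0 : 0 < m) (hm1 : m < 1)
    (νmin : ℕ → ℝ) (hmin : IsInvMeasure q m νmin) (hmin1 : HasSum νmin 1)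
    (α : ℝ) (hα : α ∈ Set.Ioo (0 : ℝ) 1)
    (ν : ℕ → ℝ) (hν0 : ∀ n, 0 ≤ ν n) (hν00 : ν 0 = 0) (hν1 : HasSum ν 1) :
    IsInvMeasure q (m ^ α) ν ↔
      ∃ Λ : Measure ℝ, IsLocFiniteOnPos Λ ∧ ScaleInvariant m Λ ∧
        (∫ x in Set.Ioi (0 : ℝ), (1 - Real.exp (-x)) * x ^ (-α) ∂Λ) = 1 ∧
        ∀ z ∈ Set.Ioo (0 : ℝ) 1,
          ∑' n, ν n * z ^ n =
            ∫ x in Set.Ioi (0 : ℝ),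
              (Real.exp (((∑' n, νmin n * z ^ n) - 1) * x) - Real.exp (-x)) * x ^ (-α) ∂Λ := by
  constructor
  · intro hinv
    exact forward q hq0 hq1 m hm hm0 hm1 νmin hmin hmin1 α hα ν hν1 hinv
  · rintro ⟨Λ, -, hΛ, h1, hgf⟩
    exact backward q hq0 hq1 m hm hm0 hm1 νmin hmin hmin1 α ν hν0 hν00 hν1 Λ hΛ h1 hgf
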